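/- Let W_b be a symmetrized joint channel (successive form, D-value representation) with a-channel marginal W_a, canonical b-channel marginal W_b*, and upgrade-couple channel Ŵ_b. Let Q_a be obtained from W_a by one upgrade-merge-3 step. Then there exists a joint channel Q̂_b with Q̂_b ≽p Ŵ_b whose canonical a-channel marginal equals the canonical channel Q_a* of Q_a, and whose canonical b-channel marginal equals W_b*. -/

import Mathlib

open Finset

/-- `W y u` is the probability that the channel outputs `y` given input `u`. -/
def IsChannel {Y U : Type*} [Fintype Y] (W : Y → U → ℝ) : Prop :=
  (∀ y u, 0 ≤ W y u) ∧ ∀ u, ∑ y, W y u = 1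

/-- A randomized decoder: `φ y u` is the probability of declaring `u` upon observing `y`. -/
def IsDecoder {Y : Type*} (φ : Y → Bool → ℝ) : Prop :=
  (∀ y u, 0 ≤ φ y u) ∧ ∀ y, ∑ u, φ y u = 1

/-- A joint channel with two binary inputs and outputs in `Ya × Yb`. -/
def IsJointChannel {Ya Yb : Type*} [Fintype Ya] [Fintype Yb]
    (W : Ya → Yb → Bool → Bool → ℝ) : Prop :=
  (∀ ya yb ua ub, 0 ≤ W ya yb ua ub) ∧ ∀ ua ub, ∑ ya, ∑ yb, W ya yb ua ub = 1

/-- a-channel marginal of a joint channel (inputs equiprobable). -/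
noncomputable def margA {Ya Yb : Type*} [Fintype Ya] [Fintype Yb]
    (W : Ya → Yb → Bool → Bool → ℝ) (ya : Ya) (ua : Bool) : ℝ :=
  (1 / 2) * ∑ ub, ∑ yb, W ya yb ua ub

/-- b-channel marginal of a joint channel (inputs equiprobable). -/
noncomputable def margB {Ya Yb : Type*} [Fintype Ya] [Fintype Yb]
    (W : Ya → Yb → Bool → Bool → ℝ) (yb : Yb) (ub : Bool) : ℝ :=
  (1 / 2) * ∑ ua, ∑ ya, W ya yb ua ub

/-- `P(E_a ∪ E_b)`: the probability that at least one of the two decoders errs. -/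
noncomputable def PerrUnion {Ya Yb : Type*} [Fintype Ya] [Fintype Yb]
    (W : Ya → Yb → Bool → Bool → ℝ)
    (φa : Ya → Bool → ℝ) (φb : Yb → Bool → ℝ) : ℝ :=
  1 - (1 / 4) * ∑ ua, ∑ ub, ∑ ya, ∑ yb, W ya yb ua ub * φa ya ua * φb yb ub

/-- Successive form: the b-output is `(y_a, u_a, y_r)` with probability one. -/
def SuccessiveForm {Ya Yr : Type*} [Fintype Ya] [Fintype Yr] [DecidableEq Ya]
    (W : Ya → Ya × Bool × Yr → Bool → Bool → ℝ) : Prop :=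
  ∀ ya ya' ua' yr ua ub,
    W ya (ya', ua', yr) ua ub =
      if ya' = ya ∧ ua' = ua then 2 * margB W (ya, ua, yr) ub else 0

/-- A maximum-likelihood decoder for the binary-input channel `V`. -/
def IsMLDecoder {Y : Type*} (V : Y → Bool → ℝ) (φ : Y → Bool → ℝ) : Prop :=
  ∀ y u, 0 < φ y u → V y u = max (V y false) (V y true)

/-- `W` is stochastically degraded from `Q`. -/
def Degraded {Y Z U : Type*} [Fintype Y] [Fintype Z]
    (W : Y → U → ℝ) (Q : Z → U → ℝ) : Prop :=
  ∃ P : Z → Y → ℝ,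
    (∀ z y, 0 ≤ P z y) ∧ (∀ z, ∑ y, P z y = 1) ∧
    ∀ y u, W y u = ∑ z, P z y * Q z u

/-- `Q` is properly upgraded from `W` (both joint channels in successive form). -/
def ProperUpgrade {Ya Yr Za Zr : Type*}
    [Fintype Ya] [Fintype Yr] [Fintype Za] [Fintype Zr]
    (Q : Za → Za × Bool × Zr → Bool → Bool → ℝ)
    (W : Ya → Ya × Bool × Yr → Bool → Bool → ℝ) : Prop :=
  ∃ (Pa : Za → Ya → ℝ) (Pb : Za → Bool → Zr → Ya → Yr → ℝ),
    (∀ za ya, 0 ≤ Pa za ya) ∧ (∀ za, ∑ ya, Pa za ya = 1) ∧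
    (∀ za ua zr ya yr, 0 ≤ Pb za ua zr ya yr) ∧
    (∀ za ua zr ya, ∑ yr, Pb za ua zr ya yr = 1) ∧
    ∀ ya ua yr ub,
      margB W (ya, ua, yr) ub =
        ∑ za, ∑ zr, Pa za ya * Pb za ua zr ya yr * margB Q (za, ua, zr) ub

/-- The minimum over decoder pairs of `P(E_a ∪ E_b)`. -/
noncomputable def PeIMJP {Ya Yb : Type*} [Fintype Ya] [Fintype Yb]
    (W : Ya → Yb → Bool → Bool → ℝ) : ℝ :=
  sInf {p : ℝ | ∃ φa φb, IsDecoder φa ∧ IsDecoder φb ∧ p = PerrUnion W φa φb}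

/-- Error probability of an ML decoder for a binary-input channel with equiprobable inputs. -/
noncomputable def PeML {Y : Type*} [Fintype Y] (V : Y → Bool → ℝ) : ℝ :=
  1 - (1 / 2) * ∑ y, max (V y false) (V y true)

/-- The `D`-value of an output of a binary-input channel. -/
noncomputable def dval {Y : Type*} (V : Y → Bool → ℝ) (y : Y) : ℝ :=
  (V y false - V y true) / (V y false + V y true)

/-- D-value representation: the third component of each positive-probability b-output
is its b-channel D-value (`v` gives the real value of a rest symbol). -/
def DvalRepJoint {Ya R : Type*} [Fintype Ya] [Fintype R]
    (W : Ya → Ya × Bool × R → Bool → Bool → ℝ) (v : R → ℝ) : Prop :=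
  ∀ ya ua r,
    0 < margB W (ya, ua, r) false + margB W (ya, ua, r) true →
    v r = dval (margB W) (ya, ua, r)

/-- A symmetrized joint channel (successive form, D-value representation). -/
def SymmetrizedJoint {Ya R : Type*} [Fintype Ya] [Fintype R]
    (W : Ya → Ya × Bool × R → Bool → Bool → ℝ)
    (v : R → ℝ) (bar : Ya → Ya) (neg : R → R) : Prop :=
  Function.Involutive bar ∧ Function.Involutive neg ∧
  (∀ r, v (neg r) = -v r) ∧
  (∀ ya ua, margA W ya ua = margA W (bar ya) (!ua)) ∧
  (∀ ya ua r ub,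
    margB W (ya, ua, r) ub = margB W (bar ya, !ua, r) ub ∧
    margB W (ya, ua, r) ub = margB W (ya, ua, neg r) (!ub) ∧
    margB W (ya, ua, r) ub = margB W (bar ya, !ua, neg r) (!ub))

/-- A decoupling decomposition `W_b = (1/2)·W_a·W_2` of a symmetrized joint channel. -/
def DecouplingDecomp {Ya R : Type*} [Fintype Ya] [Fintype R]
    (W : Ya → Ya × Bool × R → Bool → Bool → ℝ)
    (W2 : R → Bool → Ya → Bool → ℝ) : Prop :=
  (∀ r ub ya ua, 0 ≤ W2 r ub ya ua) ∧
  (∀ ya ua ub, ∑ r, W2 r ub ya ua = 1) ∧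
  ∀ ya ua r ub, margB W (ya, ua, r) ub = (1 / 2) * margA W ya ua * W2 r ub ya ua

/-- The real value of a signed D-value symbol: `(s, i)` stands for `+d_{bi}` if `s = false`
and `−d_{bi}` if `s = true`. -/
noncomputable def vD {B : ℕ} (dB : Fin B → ℝ) : Bool × Fin B → ℝ :=
  fun r => if r.1 then -dB r.2 else dB r.2

/-- Negation (conjugation) of a signed D-value symbol. -/
def negD {B : ℕ} : Bool × Fin B → Bool × Fin B := fun r => (!r.1, r.2)

/-- The splitting factor `S_{i,j}(y_a, u_a, d_b)` of the upgrade-couple transform. -/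
noncomputable def Sfac {Ya : Type*} {B : ℕ}
    (W2 : Bool × Fin B → Bool → Ya → Bool → ℝ)
    (i j : Fin B) (ya : Ya) (ua : Bool) (r : Bool × Fin B) : ℝ :=
  if ua = false then
    (if r.2 = i then ∑ ub, W2 (false, j) ub ya true else 0)
  else
    (if r.2 = j then ∑ ub, W2 (false, i) ub ya false else 0)

/-- `α_{i,j}(y_a) = S_{i,j}(y_a,0,d_{bi}) · S_{i,j}(y_a,1,d_{bj})`. -/
noncomputable def alphaFac {Ya : Type*} {B : ℕ}
    (W2 : Bool × Fin B → Bool → Ya → Bool → ℝ) (i j : Fin B) (ya : Ya) : ℝ :=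
  Sfac W2 i j ya false (false, i) * Sfac W2 i j ya true (false, j)

/-- The upgrade-couple joint channel `Ŵ_{a,b}`, in successive form, with a-outputs
`y_a^{i,j} = (y_a, i, j)` and b-marginal
`Ŵ_b(y_a^{i,j}, u_a, d_b | u_b) = W_b(y_a, u_a, d_b | u_b) · S_{i,j}(y_a, u_a, d_b)`. -/
noncomputable def upgradeCouple {Ya : Type*} [Fintype Ya] [DecidableEq Ya] {B : ℕ}
    (W : Ya → Ya × Bool × (Bool × Fin B) → Bool → Bool → ℝ)
    (W2 : Bool × Fin B → Bool → Ya → Bool → ℝ) :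
    Ya × Fin B × Fin B →
      (Ya × Fin B × Fin B) × Bool × (Bool × Fin B) → Bool → Bool → ℝ :=
  fun p q ua ub =>
    if q.1 = p ∧ q.2.1 = ua then
      2 * (margB W (p.1, ua, q.2.2) ub * Sfac W2 p.2.1 p.2.2 p.1 ua q.2.2)
    else 0

/-- The output alphabet obtained from `Ya` by removing the symbols in `S` and adding two new
conjugate symbol pairs `z_1, z̄_1, z_3, z̄_3` (encoded as `Bool × Bool`: the first component
is the conjugation sign, the second selects between `z_1` and `z_3`). -/
abbrev mergeAlphabet {Ya : Type*} [DecidableEq Ya] (S : Finset Ya) : Type _ :=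
  {y : Ya // y ∉ S} ⊕ (Bool × Bool)

/-- The joint channel in successive form whose b-channel marginal is `H`. -/
def ofMargB {Z R : Type*} [DecidableEq Z] (H : Z → Bool → R → Bool → ℝ) :
    Z → Z × Bool × R → Bool → Bool → ℝ :=
  fun p q ua ub => if q.1 = p ∧ q.2.1 = ua then 2 * H p ua q.2.2 ub else 0

lemma margB_ofMargB {Z R : Type*} [Fintype Z] [Fintype R] [DecidableEq Z]
    (H : Z → Bool → R → Bool → ℝ) (p : Z) (ua : Bool) (r : R) (ub : Bool) :
    margB (ofMargB H) (p, ua, r) ub = H p ua r ub := by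
  cases ua <;> simp [margB, ofMargB]

lemma sum_ofMargB {Z R : Type*} [Fintype Z] [Fintype R] [DecidableEq Z]
    (H : Z → Bool → R → Bool → ℝ) (p : Z) (ua ub : Bool) :
    ∑ q, ofMargB H p q ua ub = 2 * ∑ r, H p ua r ub := by
  rw [Fintype.sum_prod_type, Finset.sum_eq_single p]
  · cases ua <;> simp [Fintype.sum_prod_type, ofMargB, Finset.mul_sum]
  · intro b _ hb
    simp [ofMargB, hb]
  · simp

lemma margA_ofMargB {Z R : Type*} [Fintype Z] [Fintype R] [DecidableEq Z]
    (H : Z → Bool → R → Bool → ℝ) (p : Z) (ua : Bool) :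
    margA (ofMargB H) p ua = ∑ ub, ∑ r, H p ua r ub := by
  unfold margA
  simp only [sum_ofMargB, ← Finset.mul_sum]
  ring

lemma successiveForm_ofMargB {Z R : Type*} [Fintype Z] [Fintype R] [DecidableEq Z]
    (H : Z → Bool → R → Bool → ℝ) : SuccessiveForm (ofMargB H) := by
  intro ya ya' ua' yr ua ub
  rw [margB_ofMargB]
  rfl

lemma upgradeCouple_eq_ofMargB {Ya : Type*} [Fintype Ya] [DecidableEq Ya] {B : ℕ}
    (W : Ya → Ya × Bool × (Bool × Fin B) → Bool → Bool → ℝ)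
    (W2 : Bool × Fin B → Bool → Ya → Bool → ℝ) :
    upgradeCouple W W2 = ofMargB (fun p ua r ub =>
      margB W (p.1, ua, r) ub * Sfac W2 p.2.1 p.2.2 p.1 ua r) := rfl

/-- An output whose law is a multiple of the law of `y'` can be tested for its D-value on `y'`. -/
lemma ite_dval_of_proportional {Y Y' : Type*} {V : Y → Bool → ℝ} {s : Y' → Bool → ℝ}
    {y : Y} {y' : Y'} {c : ℝ} (h : ∀ u, V y u = c * s y' u) (d : ℝ) (u : Bool) :
    (if dval V y = d then V y u else 0) = if dval s y' = d then V y u else 0 := by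
  by_cases hc : c = 0
  · simp [h, hc]
  · have : dval V y = dval s y' := by
      simp only [dval, h, ← mul_sub, ← mul_add]
      exact mul_div_mul_left _ _ hc
    rw [this]

lemma dval_le_one {Y : Type*} {V : Y → Bool → ℝ} {y : Y} (h : ∀ u, 0 ≤ V y u) :
    dval V y ≤ 1 :=
  div_le_one_of_le₀ (by linarith [h true]) (add_nonneg (h false) (h true))

lemma neg_one_le_dval {Y : Type*} {V : Y → Bool → ℝ} {y : Y} (h : ∀ u, 0 ≤ V y u) :
    -1 ≤ dval V y := by
  have h0 := h false
  have h1 := h true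
  unfold dval
  rcases (add_nonneg h0 h1).eq_or_lt with hs | hs
  · rw [← hs]; simp
  · rw [le_div_iff₀ hs]; linarith

/-- The law of a binary-input channel at an output with D-value `d` and unit total weight. -/
noncomputable def dlaw (d : ℝ) (u : Bool) : ℝ := (1 + (if u = true then (-1 : ℝ) else 1) * d) / 2

lemma dlaw_nonneg {d : ℝ} (h : -1 ≤ d) (h' : d ≤ 1) (u : Bool) : 0 ≤ dlaw d u := by
  cases u <;> simp [dlaw] <;> linarith

lemma dlaw_add_dlaw_neg (d : ℝ) (u : Bool) : dlaw d u + dlaw (-d) u = 1 := by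
  unfold dlaw
  ring

lemma eq_mul_dlaw_dval {Y : Type*} {V : Y → Bool → ℝ} {y : Y} (h : ∀ u, 0 ≤ V y u) (u : Bool) :
    V y u = (V y false + V y true) * dlaw (dval V y) u := by
  have h0 := h false
  have h1 := h true
  rcases (add_nonneg h0 h1).eq_or_lt with hs | hs
  · rw [← hs]
    cases u <;> linarith
  · have : (V y false + V y true) * dval V y = V y false - V y true :=
      mul_div_cancel₀ _ hs.ne'
    cases u <;> simp only [dlaw] <;> simp <;> linarith

lemma margA_nonneg {Ya Yb : Type*} [Fintype Ya] [Fintype Yb]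
    {W : Ya → Yb → Bool → Bool → ℝ} (hW : IsJointChannel W) (y : Ya) (u : Bool) :
    0 ≤ margA W y u :=
  mul_nonneg (by norm_num)
    (Finset.sum_nonneg fun _ _ => Finset.sum_nonneg fun _ _ => hW.1 _ _ _ _)

lemma margB_nonneg {Ya Yb : Type*} [Fintype Ya] [Fintype Yb]
    {W : Ya → Yb → Bool → Bool → ℝ} (hW : IsJointChannel W) (y : Yb) (u : Bool) :
    0 ≤ margB W y u :=
  mul_nonneg (by norm_num)
    (Finset.sum_nonneg fun _ _ => Finset.sum_nonneg fun _ _ => hW.1 _ _ _ _)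

lemma sum_margA {Ya Yb : Type*} [Fintype Ya] [Fintype Yb]
    {W : Ya → Yb → Bool → Bool → ℝ} (hW : IsJointChannel W) (u : Bool) :
    ∑ y, margA W y u = 1 := by
  unfold margA
  rw [← Finset.mul_sum, Finset.sum_comm]
  simp [hW.2]

/-- The conditional probability that the b-channel D-value has index `i`. -/
noncomputable def absLaw {Ya : Type*} {B : ℕ} (W2 : Bool × Fin B → Bool → Ya → Bool → ℝ)
    (i : Fin B) (y : Ya) (ua : Bool) : ℝ := ∑ ub, W2 (false, i) ub y ua

/-- The conditional law of a signed D-value symbol given its index, with the D-values truncated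
to be at most one. -/
noncomputable def signLaw {B : ℕ} (dB : Fin B → ℝ) (r : Bool × Fin B) (ub : Bool) : ℝ :=
  dlaw (vD (fun i => min (dB i) 1) r) ub

/-- The conditional law of the b-channel D-value of an output `y_a^{i,j}`. -/
noncomputable def coupleLaw {B : ℕ} (dB : Fin B → ℝ) (i j : Fin B) (ua : Bool)
    (r : Bool × Fin B) (ub : Bool) : ℝ :=
  if r.2 = (if ua = true then j else i) then signLaw dB r ub else 0

/-- The probability that `y_a` is split into `y_a^{i,j}`. -/
noncomputable def splitLaw {Ya : Type*} {B : ℕ} (W2 : Bool × Fin B → Bool → Ya → Bool → ℝ)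
    (i j : Fin B) (y : Ya) : ℝ := absLaw W2 i y false * absLaw W2 j y true

lemma signLaw_nonneg {B : ℕ} {dB : Fin B → ℝ} (hdB0 : ∀ i, 0 ≤ dB i) (r : Bool × Fin B)
    (ub : Bool) : 0 ≤ signLaw dB r ub := by
  obtain ⟨s, i⟩ := r
  have h0 : 0 ≤ min (dB i) 1 := le_min (hdB0 i) zero_le_one
  have h1 : min (dB i) 1 ≤ 1 := min_le_right _ _
  apply dlaw_nonneg <;> cases s <;> simp only [vD, if_true, Bool.false_eq_true, if_false] <;> linarith

lemma coupleLaw_nonneg {B : ℕ} {dB : Fin B → ℝ} (hdB0 : ∀ i, 0 ≤ dB i) (i j : Fin B) (ua : Bool)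
    (r : Bool × Fin B) (ub : Bool) : 0 ≤ coupleLaw dB i j ua r ub := by
  unfold coupleLaw
  generalize (if ua = true then j else i) = k
  split_ifs
  · exact signLaw_nonneg hdB0 r ub
  · rfl

lemma sum_coupleLaw {B : ℕ} (dB : Fin B → ℝ) (i j : Fin B) (ua ub : Bool) :
    ∑ r, coupleLaw dB i j ua r ub = 1 := by
  rw [Fintype.sum_prod_type]
  simp only [coupleLaw, Finset.sum_ite_eq', Finset.mem_univ, if_true, Fintype.sum_bool]
  simp only [signLaw, vD]
  rw [add_comm]
  exact dlaw_add_dlaw_neg _ _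

section Split

variable {Ya : Type*} {B : ℕ} {W2 : Bool × Fin B → Bool → Ya → Bool → ℝ}

lemma absLaw_nonneg (h0 : ∀ r ub y ua, 0 ≤ W2 r ub y ua) (i : Fin B) (y : Ya) (ua : Bool) :
    0 ≤ absLaw W2 i y ua := Finset.sum_nonneg fun _ _ => h0 _ _ _ _

lemma absLaw_eq (hneg : ∀ r ub y ua, W2 (negD r) (!ub) y ua = W2 r ub y ua)
    (r : Bool × Fin B) (y : Ya) (ua : Bool) :
    absLaw W2 r.2 y ua = W2 r false y ua + W2 r true y ua := by
  obtain ⟨s, i⟩ := r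
  cases s
  · simp [absLaw, add_comm]
  · have h1 := hneg (true, i) false y ua
    have h2 := hneg (true, i) true y ua
    simp only [negD, Bool.not_true, Bool.not_false] at h1 h2
    simp [absLaw, h1, h2]

lemma sum_absLaw (hneg : ∀ r ub y ua, W2 (negD r) (!ub) y ua = W2 r ub y ua)
    (hsum : ∀ y ua ub, ∑ r, W2 r ub y ua = 1) (y : Ya) (ua : Bool) :
    ∑ i, absLaw W2 i y ua = 1 := by
  rw [← hsum y ua false, Fintype.sum_prod_type, Fintype.sum_bool, ← Finset.sum_add_distrib]
  refine Finset.sum_congr rfl fun i _ => ?_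
  have h2 := hneg (true, i) false y ua
  simp only [negD, Bool.not_true, Bool.not_false] at h2
  simp [absLaw, h2]

lemma splitLaw_nonneg (h0 : ∀ r ub y ua, 0 ≤ W2 r ub y ua) (i j : Fin B) (y : Ya) :
    0 ≤ splitLaw W2 i j y := mul_nonneg (absLaw_nonneg h0 _ _ _) (absLaw_nonneg h0 _ _ _)

lemma sum_splitLaw_mul_coupleLaw (hneg : ∀ r ub y ua, W2 (negD r) (!ub) y ua = W2 r ub y ua)
    (hsum : ∀ y ua ub, ∑ r, W2 r ub y ua = 1) (dB : Fin B → ℝ) (y : Ya) (ua : Bool)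
    (r : Bool × Fin B) (ub : Bool) :
    ∑ i, ∑ j, splitLaw W2 i j y * coupleLaw dB i j ua r ub =
      absLaw W2 r.2 y ua * signLaw dB r ub := by
  cases ua
  · simp [splitLaw, coupleLaw, ← Finset.sum_mul, ← Finset.mul_sum, sum_absLaw hneg hsum]
  · simp [splitLaw, coupleLaw, ← Finset.sum_mul, sum_absLaw hneg hsum]

lemma sum_splitLaw (hneg : ∀ r ub y ua, W2 (negD r) (!ub) y ua = W2 r ub y ua)
    (hsum : ∀ y ua ub, ∑ r, W2 r ub y ua = 1) (y : Ya) :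
    ∑ i, ∑ j, splitLaw W2 i j y = 1 := by
  simp [splitLaw, ← Finset.mul_sum, sum_absLaw hneg hsum]

end Split

lemma margB_eq_signLaw {Ya : Type*} [Fintype Ya] {B : ℕ}
    {W : Ya → Ya × Bool × (Bool × Fin B) → Bool → Bool → ℝ} {dB : Fin B → ℝ}
    {W2 : Bool × Fin B → Bool → Ya → Bool → ℝ}
    (hW : IsJointChannel W) (hrep : DvalRepJoint W (vD dB)) (hdec : DecouplingDecomp W W2)
    (hneg : ∀ r ub y ua, W2 (negD r) (!ub) y ua = W2 r ub y ua)
    (y : Ya) (ua : Bool) (r : Bool × Fin B) (ub : Bool) :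
    margB W (y, ua, r) ub =
      1 / 2 * margA W y ua * absLaw W2 r.2 y ua * signLaw dB r ub := by
  have hm := fun u => margB_nonneg hW (y, ua, r) u
  have hs : margB W (y, ua, r) false + margB W (y, ua, r) true =
      1 / 2 * margA W y ua * absLaw W2 r.2 y ua := by
    rw [absLaw_eq hneg, hdec.2.2, hdec.2.2]
    ring
  rw [eq_mul_dlaw_dval hm ub, hs]
  rcases (add_nonneg (hm false) (hm true)).eq_or_lt with h | h
  · rw [← hs, ← h]
    simp
  · have hv := hrep y ua r h
    have hle := dval_le_one hm
    have hge := neg_one_le_dval hm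
    rw [← hv] at hle hge ⊢
    have : min (dB r.2) 1 = dB r.2 := by
      obtain ⟨s, i⟩ := r
      apply min_eq_left
      cases s <;> simp [vD] at hle hge <;> linarith
    simp [signLaw, vD, this]

lemma margB_upgradeCouple {Ya : Type*} [Fintype Ya] [DecidableEq Ya] {B : ℕ}
    {W : Ya → Ya × Bool × (Bool × Fin B) → Bool → Bool → ℝ} {dB : Fin B → ℝ}
    {W2 : Bool × Fin B → Bool → Ya → Bool → ℝ}
    (hW : IsJointChannel W) (hrep : DvalRepJoint W (vD dB)) (hdec : DecouplingDecomp W W2)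
    (hneg : ∀ r ub y ua, W2 (negD r) (!ub) y ua = W2 r ub y ua)
    (y : Ya) (i j : Fin B) (ua : Bool) (r : Bool × Fin B) (ub : Bool) :
    margB (upgradeCouple W W2) ((y, i, j), ua, r) ub =
      1 / 2 * (margA W y ua * splitLaw W2 i j y) * coupleLaw dB i j ua r ub := by
  rw [upgradeCouple_eq_ofMargB, margB_ofMargB, margB_eq_signLaw hW hrep hdec hneg]
  cases ua
  · by_cases h : r.2 = i
    · simp only [Sfac, splitLaw, coupleLaw, absLaw, h]
      simp
      ring
    · simp [Sfac, coupleLaw, h]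
  · by_cases h : r.2 = j
    · simp only [Sfac, splitLaw, coupleLaw, absLaw, h]
      simp
      ring
    · simp [Sfac, coupleLaw, h]

/-- If both `W_a` and `Q_a` are marginals of the same mixture `q z y * s z u`, then the
upgrade `Q_a` of `W_a` lifts to a proper upgrade of the upgrade-couple channel which keeps the
canonical marginals. -/
theorem exists_properUpgrade_upgradeCouple {Ya Z : Type*} [Fintype Ya] [DecidableEq Ya]
    [Fintype Z] [DecidableEq Z] [Nonempty Ya] {B : ℕ}
    {W : Ya → Ya × Bool × (Bool × Fin B) → Bool → Bool → ℝ} {dB : Fin B → ℝ}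
    {W2 : Bool × Fin B → Bool → Ya → Bool → ℝ}
    (hW : IsJointChannel W) (hdB0 : ∀ i, 0 ≤ dB i)
    (hrep : DvalRepJoint W (vD dB)) (hdec : DecouplingDecomp W W2)
    (hneg : ∀ r ub y ua, W2 (negD r) (!ub) y ua = W2 r ub y ua)
    {Qa : Z → Bool → ℝ} (s : Z → Bool → ℝ) (q : Z → Ya → ℝ)
    (hs : ∀ z u, 0 ≤ s z u) (hq : ∀ z y, 0 ≤ q z y)
    (hWq : ∀ y u, margA W y u = ∑ z, q z y * s z u)
    (hQq : ∀ z u, Qa z u = (∑ y, q z y) * s z u) :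
    ∃ Qhat : Z × Fin B × Fin B → (Z × Fin B × Fin B) × Bool × (Bool × Fin B) →
          Bool → Bool → ℝ,
      IsJointChannel Qhat ∧ SuccessiveForm Qhat ∧
      ProperUpgrade Qhat (upgradeCouple W W2) ∧
      (∀ (da : ℝ) (ua : Bool),
        (∑ z ∈ Finset.univ.filter (fun z => dval (margA Qhat) z = da),
          margA Qhat z ua) =
        ∑ z ∈ Finset.univ.filter (fun z => dval Qa z = da), Qa z ua) ∧
      (∀ (db : ℝ) (ub : Bool),
        (∑ t ∈ Finset.univ.filter (fun t => dval (margB Qhat) t = db),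
          margB Qhat t ub) =
        ∑ t ∈ Finset.univ.filter (fun t => dval (margB W) t = db),
          margB W t ub) := by
  obtain ⟨h0, hsum, -⟩ := id hdec
  -- the weight of `z^{i,j}`
  let M : Z → Fin B → Fin B → ℝ := fun z i j => ∑ y, splitLaw W2 i j y * q z y
  have hm0 : ∀ z i j y, 0 ≤ splitLaw W2 i j y * q z y := fun z i j y =>
    mul_nonneg (splitLaw_nonneg h0 i j y) (hq z y)
  have hM0 : ∀ z i j, 0 ≤ M z i j := fun z i j => Finset.sum_nonneg fun y _ => hm0 z i j y
  let H : Z × Fin B × Fin B → Bool → Bool × Fin B → Bool → ℝ := fun p ua r ub =>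
    1 / 2 * (M p.1 p.2.1 p.2.2 * s p.1 ua) * coupleLaw dB p.2.1 p.2.2 ua r ub
  have hH0 : ∀ p ua r ub, 0 ≤ H p ua r ub := fun p ua r ub =>
    mul_nonneg (mul_nonneg (by norm_num) (mul_nonneg (hM0 _ _ _) (hs _ _)))
      (coupleLaw_nonneg hdB0 _ _ _ _ _)
  have hA : ∀ z i j ua, margA (ofMargB H) (z, i, j) ua = M z i j * s z ua := by
    intro z i j ua
    rw [margA_ofMargB]
    simp only [H, ← Finset.mul_sum, sum_coupleLaw]
    simp
    ring
  have hMsum : ∀ z, ∑ i, ∑ j, M z i j = ∑ y, q z y := by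
    intro z
    simp only [M]
    simp_rw [Finset.sum_comm (s := (univ : Finset (Fin B))) (t := (univ : Finset Ya))]
    simp only [← Finset.sum_mul, sum_splitLaw hneg hsum, one_mul]
  have hMs : ∀ i j ua, ∑ z, M z i j * s z ua = ∑ y, splitLaw W2 i j y * margA W y ua := by
    intro i j ua
    simp only [M, hWq, Finset.sum_mul, Finset.mul_sum]
    rw [Finset.sum_comm]
    simp only [mul_assoc]
  refine ⟨ofMargB H, ⟨?_, ?_⟩, successiveForm_ofMargB H, ?_, ?_, ?_⟩
  · intro p t ua ub
    unfold ofMargB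
    split_ifs
    · exact mul_nonneg (by norm_num) (hH0 _ _ _ _)
    · rfl
  · intro ua ub
    simp only [sum_ofMargB, H, ← Finset.mul_sum, sum_coupleLaw]
    simp only [Fintype.sum_prod_type, mul_one, ← Finset.mul_sum, ← Finset.sum_mul, hMsum]
    simp only [Finset.sum_mul]
    rw [Finset.sum_comm]
    simp [← hWq, sum_margA hW]
  · let y0 : Ya := Classical.arbitrary Ya
    refine ⟨fun p t => if p.2 = t.2 then
        (if M p.1 p.2.1 p.2.2 = 0 then (if t.1 = y0 then 1 else 0)
          else splitLaw W2 p.2.1 p.2.2 t.1 * q p.1 t.1 / M p.1 p.2.1 p.2.2) else 0,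
      fun _ _ zr _ yr => if zr = yr then 1 else 0, ?_, ?_, ?_, ?_, ?_⟩
    · intro p t
      dsimp only
      split_ifs
      · exact zero_le_one
      · rfl
      · exact div_nonneg (hm0 _ _ _ _) (hM0 _ _ _)
      · rfl
    · rintro ⟨z, ij⟩
      rw [Fintype.sum_prod_type]
      simp only [Finset.sum_ite_eq, Finset.mem_univ, if_true]
      split_ifs with h
      · simp
      · rw [← Finset.sum_div]
        exact div_self h
    · intros
      dsimp only
      split_ifs <;> norm_num
    · intros
      simp
    · rintro ⟨y, i, j⟩ ua yr ub
      rw [margB_upgradeCouple hW hrep hdec hneg, Fintype.sum_prod_type, hWq]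
      simp only [margB_ofMargB, mul_ite, mul_one, mul_zero, ite_mul, zero_mul,
        Finset.sum_ite_eq', Finset.mem_univ, if_true, H]
      rw [Finset.sum_mul, Finset.mul_sum, Finset.sum_mul]
      refine Finset.sum_congr rfl fun z _ => ?_
      by_cases h : M z i j = 0
      · have h2 : splitLaw W2 i j y * q z y = 0 :=
          (Finset.sum_eq_zero_iff_of_nonneg fun y _ => hm0 z i j y).1 h y (Finset.mem_univ y)
        simp only [h, zero_mul, mul_zero, ite_self]
        linear_combination (1 / 2 * s z ua * coupleLaw dB i j ua yr ub) * h2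
      · rw [if_neg h]
        field_simp
  · intro da ua
    rw [Finset.sum_filter, Finset.sum_filter, Fintype.sum_prod_type]
    refine Finset.sum_congr rfl fun z _ => ?_
    rw [ite_dval_of_proportional (hQq z), Fintype.sum_prod_type]
    simp_rw [fun i j => ite_dval_of_proportional (hA z i j) da ua]
    split_ifs
    · simp_rw [hA, ← Finset.sum_mul]
      rw [hMsum, hQq]
    · simp
  · intro db ub
    have hB : ∀ p ua r u, margB (ofMargB H) (p, ua, r) u =
        (if r.2 = (if ua = true then p.2.2 else p.2.1) then
          1 / 2 * (M p.1 p.2.1 p.2.2 * s p.1 ua) else 0) * signLaw dB r u := by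
      intro p ua r u
      rw [margB_ofMargB]
      simp only [H, coupleLaw]
      split_ifs <;> simp
    rw [Finset.sum_filter, Finset.sum_filter]
    simp only [Fintype.sum_prod_type (α₁ := Bool) (α₂ := Bool × Fin B),
      Fintype.sum_prod_type (α₂ := Bool × Bool × Fin B)]
    simp_rw [fun p ua r => ite_dval_of_proportional (hB p ua r) db ub,
      fun y ua r => ite_dval_of_proportional
        (margB_eq_signLaw hW hrep hdec hneg y ua r) db ub]
    rw [Finset.sum_comm]
    conv_rhs => rw [Finset.sum_comm]
    refine Finset.sum_congr rfl fun ua _ => ?_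
    rw [Finset.sum_comm]
    conv_rhs => rw [Finset.sum_comm]
    refine Finset.sum_congr rfl fun r _ => ?_
    split_ifs
    · have hY : ∀ y, margB W (y, ua, r) ub = 1 / 2 * margA W y ua *
          ∑ i, ∑ j, splitLaw W2 i j y * coupleLaw dB i j ua r ub := by
        intro y
        rw [sum_splitLaw_mul_coupleLaw hneg hsum, margB_eq_signLaw hW hrep hdec hneg]
        ring
      simp_rw [hY, margB_ofMargB, H, Finset.mul_sum]
      rw [Fintype.sum_prod_type, Finset.sum_comm, Finset.sum_comm (s := (univ : Finset Ya)),
        Fintype.sum_prod_type]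
      refine Finset.sum_congr rfl fun i _ => ?_
      rw [Finset.sum_comm (s := (univ : Finset Ya))]
      refine Finset.sum_congr rfl fun j _ => ?_
      dsimp only
      rw [← Finset.sum_mul, ← Finset.mul_sum, hMs, Finset.mul_sum, Finset.sum_mul]
      refine Finset.sum_congr rfl fun y _ => ?_
      ring
    · simp

/-- Let `W` be a symmetrized joint channel with upgrade-couple channel
`Ŵ = upgradeCouple W W2`, and let `Q_a` be obtained from `W_a` by one upgrade-merge-3 step
(on conjugate pairs `{y_1,ȳ_1}, {y_2,ȳ_2}, {y_3,ȳ_3}` with nonnegative a-channel D-values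
`d_1 ≤ d_2 ≤ d_3`, `d_1 < d_3`). Then there is a joint channel `Q̂` with `Q̂ ≽p Ŵ` whose
canonical a-channel marginal equals that of `Q_a` and whose canonical b-channel marginal
equals that of `W_b`. -/
theorem stmt17 {Ya : Type*} [Fintype Ya] [DecidableEq Ya] {B : ℕ}
    (W : Ya → Ya × Bool × (Bool × Fin B) → Bool → Bool → ℝ)
    (dB : Fin B → ℝ) (bar : Ya → Ya)
    (hW : IsJointChannel W) (hsucc : SuccessiveForm W)
    (hdB0 : ∀ i, 0 ≤ dB i) (hdBmono : Monotone dB)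
    (hrep : DvalRepJoint W (vD dB))
    (hsym : SymmetrizedJoint W (vD dB) bar negD)
    (W2 : Bool × Fin B → Bool → Ya → Bool → ℝ)
    (hdec : DecouplingDecomp W W2)
    (hW2neg : ∀ r ub ya ua, W2 (negD r) (!ub) ya ua = W2 r ub ya ua)
    (hW2bar : ∀ r ub ya ua, W2 r ub (bar ya) (!ua) = W2 r ub ya ua)
    -- the three conjugate symbol pairs chosen for the upgrade-merge-3 step:
    (y1 y2 y3 : Ya)
    (hnodup : ([y1, bar y1, y2, bar y2, y3, bar y3] : List Ya).Nodup)
    (d1 d2 d3 p1 p2 p3 : ℝ)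
    (hd1 : d1 = dval (margA W) y1) (hd2 : d2 = dval (margA W) y2)
    (hd3 : d3 = dval (margA W) y3)
    (hp1 : p1 = margA W y1 false + margA W y1 true)
    (hp2 : p2 = margA W y2 false + margA W y2 true)
    (hp3 : p3 = margA W y3 false + margA W y3 true)
    (hord0 : 0 ≤ d1) (hord1 : d1 ≤ d2) (hord2 : d2 ≤ d3) (hord3 : d1 < d3)
    -- the channel `Q_a` produced by the upgrade-merge-3 step:
    (Qa : mergeAlphabet ({y1, bar y1, y2, bar y2, y3, bar y3} : Finset Ya) → Bool → ℝ)
    (hQaIn : ∀ y u, Qa (Sum.inl y) u = margA W y.1 u)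
    (hQz1 : ∀ u, Qa (Sum.inr (false, false)) u =
      (p1 + p2 * ((d3 - d2) / (d3 - d1))) *
        (1 + (if u = true then (-1 : ℝ) else 1) * d1) / 2)
    (hQz1c : ∀ u, Qa (Sum.inr (true, false)) u = Qa (Sum.inr (false, false)) (!u))
    (hQz3 : ∀ u, Qa (Sum.inr (false, true)) u =
      (p3 + p2 * ((d2 - d1) / (d3 - d1))) *
        (1 + (if u = true then (-1 : ℝ) else 1) * d3) / 2)
    (hQz3c : ∀ u, Qa (Sum.inr (true, true)) u = Qa (Sum.inr (false, true)) (!u)) :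
    ∃ Qhat :
        mergeAlphabet ({y1, bar y1, y2, bar y2, y3, bar y3} : Finset Ya) × Fin B × Fin B →
          (mergeAlphabet ({y1, bar y1, y2, bar y2, y3, bar y3} : Finset Ya) ×
              Fin B × Fin B) × Bool × (Bool × Fin B) →
          Bool → Bool → ℝ,
      IsJointChannel Qhat ∧ SuccessiveForm Qhat ∧
      ProperUpgrade Qhat (upgradeCouple W W2) ∧
      -- the canonical a-channel marginal of `Q̂` equals the canonical channel of `Q_a`:
      (∀ (da : ℝ) (ua : Bool),
        (∑ z ∈ Finset.univ.filter (fun z => dval (margA Qhat) z = da),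
          margA Qhat z ua) =
        ∑ z ∈ Finset.univ.filter (fun z => dval Qa z = da), Qa z ua) ∧
      -- the canonical b-channel marginal of `Q̂` equals that of `W`:
      (∀ (db : ℝ) (ub : Bool),
        (∑ t ∈ Finset.univ.filter (fun t => dval (margB Qhat) t = db),
          margB Qhat t ub) =
        ∑ t ∈ Finset.univ.filter (fun t => dval (margB W) t = db),
          margB W t ub) := by
  have hA0 := margA_nonneg hW
  have hbarA : ∀ y u, margA W (bar y) u = margA W y (!u) := by
    intro y u
    rw [hsym.2.2.2.1 y (!u), Bool.not_not]
  have hd3le : d3 ≤ 1 := hd3 ▸ dval_le_one (hA0 y3)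
  have hd : 0 < d3 - d1 := sub_pos.2 hord3
  have hl1 : 0 ≤ (d3 - d2) / (d3 - d1) := div_nonneg (by linarith) hd.le
  have hl3 : 0 ≤ (d2 - d1) / (d3 - d1) := div_nonneg (by linarith) hd.le
  have hp1' : 0 ≤ p1 := hp1 ▸ add_nonneg (hA0 _ _) (hA0 _ _)
  have hp2' : 0 ≤ p2 := hp2 ▸ add_nonneg (hA0 _ _) (hA0 _ _)
  have hp3' : 0 ≤ p3 := hp3 ▸ add_nonneg (hA0 _ _) (hA0 _ _)
  have e1 : ∀ u, margA W y1 u = p1 * dlaw d1 u := fun u => by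
    rw [hp1, hd1, ← eq_mul_dlaw_dval (hA0 y1)]
  have e3 : ∀ u, margA W y3 u = p3 * dlaw d3 u := fun u => by
    rw [hp3, hd3, ← eq_mul_dlaw_dval (hA0 y3)]
  have e2 : ∀ u, margA W y2 u = p2 * ((d3 - d2) / (d3 - d1)) * dlaw d1 u +
      p2 * ((d2 - d1) / (d3 - d1)) * dlaw d3 u := by
    intro u
    have : margA W y2 u = p2 * dlaw d2 u := by
      rw [hp2, hd2, ← eq_mul_dlaw_dval (hA0 y2)]
    rw [this]
    have hne := hd.ne'
    unfold dlaw
    field_simp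
    ring
  let cb : Bool → Ya → Ya := fun c y => if c = true then bar y else y
  have : Nonempty Ya := ⟨y1⟩
  refine exists_properUpgrade_upgradeCouple hW hdB0 hrep hdec hW2neg
    (Sum.elim (fun y u => margA W y.1 u)
      (fun t u => dlaw (if t.2 = true then d3 else d1) (xor t.1 u)))
    (Sum.elim (fun y' y => if y = y'.1 then 1 else 0)
      (fun t y => if t.2 = true then
          (if y = cb t.1 y3 then p3 else 0) +
            (if y = cb t.1 y2 then p2 * ((d2 - d1) / (d3 - d1)) else 0)
        else (if y = cb t.1 y1 then p1 else 0) +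
            (if y = cb t.1 y2 then p2 * ((d3 - d2) / (d3 - d1)) else 0)))
    ?_ ?_ ?_ ?_
  · rintro (y | ⟨c, k⟩) u
    · exact hA0 _ _
    · cases k <;> exact dlaw_nonneg (by simp; linarith) (by simp; linarith) _
  · have hn1 := mul_nonneg hp2' hl1
    have hn3 := mul_nonneg hp2' hl3
    rintro (y' | ⟨c, k⟩) y
    · simp only [Sum.elim_inl]
      split_ifs <;> norm_num
    · simp only [Sum.elim_inr]
      split_ifs <;> positivity
  · intro y u
    rw [Fintype.sum_sum_type]
    simp only [Sum.elim_inl, Sum.elim_inr]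
    by_cases hy : y ∈ ({y1, bar y1, y2, bar y2, y3, bar y3} : Finset Ya)
    · have hz : ∑ x : {y // y ∉ ({y1, bar y1, y2, bar y2, y3, bar y3} : Finset Ya)},
          (if y = x.1 then (1 : ℝ) else 0) * margA W x.1 u = 0 := by
        refine Finset.sum_eq_zero fun x _ => ?_
        have hne : y ≠ x.1 := fun h => x.2 (h.subst hy)
        rw [if_neg hne, zero_mul]
      rw [hz]
      simp only [List.nodup_cons, List.mem_cons, List.not_mem_nil, not_or, or_false,
        List.nodup_nil, not_false_eq_true, and_true] at hnodup
      obtain ⟨⟨a1, a2, a3, a4, a5⟩, ⟨b1, b2, b3, b4⟩, ⟨c1, c2, c3⟩, ⟨f1, f2⟩, g1⟩ := hnodup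
      simp only [Finset.mem_insert, Finset.mem_singleton] at hy
      rcases hy with h | h | h | h | h | h <;>
        simp [Fintype.sum_prod_type, cb, hbarA, e1, e2, e3, h, a1, a2, a3, a4, a5, b1, b2, b3, b4,
          c1, c2, c3, f1, f2, g1, Ne.symm a1, Ne.symm a2, Ne.symm a3, Ne.symm a4, Ne.symm a5,
          Ne.symm b1, Ne.symm b2, Ne.symm b3, Ne.symm b4, Ne.symm c1, Ne.symm c2, Ne.symm c3,
          Ne.symm f1, Ne.symm f2, Ne.symm g1] <;> ring
    · have hz : ∀ t : Bool × Bool, (if t.2 = true then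
          (if y = cb t.1 y3 then p3 else 0) +
            (if y = cb t.1 y2 then p2 * ((d2 - d1) / (d3 - d1)) else 0)
        else (if y = cb t.1 y1 then p1 else 0) +
            (if y = cb t.1 y2 then p2 * ((d3 - d2) / (d3 - d1)) else 0)) = 0 := by
        simp only [Finset.mem_insert, Finset.mem_singleton, not_or] at hy
        rintro ⟨c, k⟩
        cases c <;> cases k <;> simp [cb, hy]
      simp only [hz, zero_mul, Finset.sum_const_zero, add_zero]
      rw [Finset.sum_eq_single (⟨y, hy⟩ : {y // y ∉ _})]
      · simp
      · intro b _ hb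
        rw [if_neg (fun h => hb (Subtype.ext h.symm)), zero_mul]
      · simp
  · rintro (y | ⟨c, k⟩) u
    · simp [hQaIn]
    · cases c <;> cases k <;>
        simp only [hQz1c, hQz3c, hQz1, hQz3, Sum.elim_inr, Finset.sum_add_distrib,
          Finset.sum_ite_eq', Finset.mem_univ, if_true, Bool.false_eq_true, if_false,
          Bool.false_xor, Bool.true_xor, dlaw] <;> ring
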